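/- arXiv:2302.00616 — 2 statements merged into one kernel-verified Lean document; each statement's English description precedes it below -/
import Mathlib

section
/- Let X and Y be jointly Gaussian random variables, each standard Gaussian (mean 0, variance 1), with correlation ρ ∈ (−1, 1). Then ℙ(X > 0, Y > 0) = 1/4 + (1/(2π))·arctan( ρ/√(1 − ρ²) ), and consequently corr(𝟙_{[X>0]}, 𝟙_{[Y>0]}) = (2/π)·arctan( ρ/√(1 − ρ²) ). -/
open MeasureTheory ProbabilityTheory Filter
open scoped ENNReal Topology

/-- The correlation coefficient of two real random variables:
`corr(Y,Z) = Cov(Y,Z) / √(Var Y ⬝ Var Z)`. -/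
noncomputable def correlation {Ω : Type*} [MeasurableSpace Ω] (μ : Measure Ω)
    (Y Z : Ω → ℝ) : ℝ :=
  ((∫ ω, Y ω * Z ω ∂μ) - (∫ ω, Y ω ∂μ) * (∫ ω, Z ω ∂μ)) /
    Real.sqrt (ProbabilityTheory.variance Y μ * ProbabilityTheory.variance Z μ)

/-- If every linear combination `a U + b V` has law `N(0, a² + b²)`, then `(U, V)` is a pair of
independent standard Gaussian variables. -/
theorem map_prodMk_eq_gaussianReal_prod {Ω : Type*} [MeasurableSpace Ω] {μ : Measure Ω}
    [IsProbabilityMeasure μ] {U V : Ω → ℝ} (hU : Measurable U) (hV : Measurable V)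
    (h : ∀ a b : ℝ, μ.map (fun ω => a * U ω + b * V ω) =
      gaussianReal 0 (a ^ 2 + b ^ 2).toNNReal) :
    μ.map (fun ω => (U ω, V ω)) = (gaussianReal 0 1).prod (gaussianReal 0 1) := by
  rw [← charFun_eq_prod_iff]
  intro t
  have hmap : charFun ((μ.map (fun ω => (U ω, V ω))).map (WithLp.toLp 2)) t =
      charFun (μ.map (fun ω => (WithLp.ofLp t).1 * U ω + (WithLp.ofLp t).2 * V ω)) 1 := by
    rw [charFun_apply, charFun_apply, integral_map (by fun_prop) (by fun_prop),
      integral_map (by fun_prop) (by fun_prop), integral_map (by fun_prop) (by fun_prop)]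
    simp [WithLp.prod_inner_apply]
  rw [hmap, h, charFun_gaussianReal, charFun_gaussianReal, charFun_gaussianReal,
    ← Complex.exp_add, Real.coe_toNNReal _ (by positivity)]
  congr 1
  push_cast
  ring

theorem gaussianReal_zero_one_Ioi_zero : gaussianReal 0 1 (Set.Ioi 0) = 2⁻¹ := by
  have hsymm : gaussianReal 0 1 (Set.Iic 0) = gaussianReal 0 1 (Set.Ioi 0) := by
    have := nullSingletonClass_gaussianReal (μ := 0) (v := 1) one_ne_zero
    rw [← measure_congr (Iio_ae_eq_Iic (a := (0 : ℝ)))]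
    conv_rhs => rw [← neg_zero, ← gaussianReal_map_neg]
    rw [Measure.map_apply measurable_neg measurableSet_Ioi]
    simp
  have hadd := prob_add_prob_compl (μ := gaussianReal 0 1) (measurableSet_Ioi (a := (0 : ℝ)))
  rw [Set.compl_Ioi, hsymm, ← two_mul] at hadd
  exact ENNReal.eq_inv_of_mul_eq_one_left (by rwa [mul_comm])

theorem lintegral_Ioi_mul_comp_mul {f : ℝ → ℝ≥0∞} (hf : Measurable f) (c : ℝ) {u : ℝ}
    (hu : 0 < u) :
    ∫⁻ w in Set.Ioi (u * c), f w = ∫⁻ v in Set.Ioi c, ENNReal.ofReal u * f (u * v) := by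
  have hpre : (fun v => u * v) ⁻¹' Set.Ioi (u * c) = Set.Ioi c := by
    ext v
    simp only [Set.mem_preimage, Set.mem_Ioi]
    exact mul_lt_mul_iff_right₀ hu
  conv_lhs => rw [← Real.smul_map_volume_mul_left hu.ne', Measure.restrict_smul,
    lintegral_smul_measure, setLIntegral_map measurableSet_Ioi hf (by fun_prop), hpre, abs_of_pos hu]
  rw [lintegral_const_mul _ (by fun_prop), smul_eq_mul]

theorem lintegral_Ioi_mul_exp_neg_mul_sq {b : ℝ} (hb : 0 < b) :
    ∫⁻ u in Set.Ioi (0 : ℝ), ENNReal.ofReal (u * Real.exp (-b * u ^ 2)) =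
      ENNReal.ofReal (2 * b)⁻¹ := by
  have hderiv (u : ℝ) : HasDerivAt (fun u => -(2 * b)⁻¹ * Real.exp (-b * u ^ 2))
      (u * Real.exp (-b * u ^ 2)) u := by
    refine ((((hasDerivAt_pow 2 u).const_mul (-b)).exp).const_mul (-(2 * b)⁻¹)).congr_deriv ?_
    simp only [Nat.cast_ofNat, Nat.add_one_sub_one, pow_one]
    field_simp
  have hlim : Tendsto (fun u : ℝ => -(2 * b)⁻¹ * Real.exp (-b * u ^ 2)) atTop (𝓝 0) := by
    have : Tendsto (fun u : ℝ => -b * u ^ 2) atTop atBot :=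
      (tendsto_pow_atTop two_ne_zero).const_mul_atTop_of_neg (by linarith)
    simpa using (Real.tendsto_exp_atBot.comp this).const_mul (-(2 * b)⁻¹)
  have hnonneg : ∀ u ∈ Set.Ioi (0 : ℝ), 0 ≤ u * Real.exp (-b * u ^ 2) := fun u hu =>
    mul_nonneg (le_of_lt hu) (Real.exp_pos _).le
  rw [← ofReal_integral_eq_lintegral_ofReal
      ((integrable_mul_exp_neg_mul_sq hb).integrableOn)
      ((ae_restrict_iff' measurableSet_Ioi).2 (ae_of_all _ hnonneg)),
    integral_Ioi_of_hasDerivAt_of_nonneg' (fun u _ => hderiv u) hnonneg hlim]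
  simp

theorem lintegral_Ioi_inv_one_add_sq (c : ℝ) :
    ∫⁻ v in Set.Ioi c, ENNReal.ofReal (1 + v ^ 2)⁻¹ =
      ENNReal.ofReal (Real.pi / 2 - Real.arctan c) := by
  rw [← ofReal_integral_eq_lintegral_ofReal integrable_inv_one_add_sq.integrableOn
    (ae_of_all _ fun v => by positivity), integral_Ioi_inv_one_add_sq]

/-- The standard Gaussian measure of the planar sector `{(u, w) | 0 < u, u c < w}`. -/
theorem gaussianReal_prod_sector (c : ℝ) :
    (gaussianReal 0 1).prod (gaussianReal 0 1) {p : ℝ × ℝ | 0 < p.1 ∧ p.1 * c < p.2} =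
      ENNReal.ofReal ((2 * Real.pi)⁻¹ * (Real.pi / 2 - Real.arctan c)) := by
  have hmeas : MeasurableSet {p : ℝ × ℝ | 0 < p.1 ∧ p.1 * c < p.2} :=
    (measurableSet_lt measurable_const measurable_fst).inter
      (measurableSet_lt (measurable_fst.mul_const c) measurable_snd)
  have hpdf (u v : ℝ) (hu : 0 < u) :
      gaussianPDF 0 1 u * (ENNReal.ofReal u * gaussianPDF 0 1 (u * v)) =
        ENNReal.ofReal (2 * Real.pi)⁻¹ *
          ENNReal.ofReal (u * Real.exp (-((1 + v ^ 2) / 2) * u ^ 2)) := by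
    simp only [gaussianPDF]
    rw [← ENNReal.ofReal_mul hu.le, ← ENNReal.ofReal_mul (gaussianPDFReal_nonneg _ _ _),
      ← ENNReal.ofReal_mul (by positivity)]
    congr 1
    have hexp : Real.exp (-((1 + v ^ 2) / 2) * u ^ 2) =
        Real.exp (-u ^ 2 / 2) * Real.exp (-(u * v) ^ 2 / 2) := by
      rw [← Real.exp_add]
      congr 1
      ring
    have hsqrt : (√(2 * Real.pi))⁻¹ * (√(2 * Real.pi))⁻¹ = (2 * Real.pi)⁻¹ := by
      rw [← mul_inv, Real.mul_self_sqrt (by positivity)]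
    simp only [gaussianPDFReal, NNReal.coe_one, mul_one, sub_zero]
    rw [hexp, ← hsqrt]
    ring
  rw [Measure.prod_apply hmeas]
  calc
    ∫⁻ u, gaussianReal 0 1 (Prod.mk u ⁻¹' {p : ℝ × ℝ | 0 < p.1 ∧ p.1 * c < p.2})
        ∂gaussianReal 0 1
      = ∫⁻ u, (Set.Ioi 0).indicator (fun u => gaussianReal 0 1 (Set.Ioi (u * c))) u
          ∂gaussianReal 0 1 := by
        refine lintegral_congr fun u => ?_
        by_cases hu : 0 < u <;> simp [hu, Set.Ioi]
    _ = ∫⁻ u in Set.Ioi 0, gaussianPDF 0 1 u * gaussianReal 0 1 (Set.Ioi (u * c)) := by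
        rw [lintegral_indicator measurableSet_Ioi, gaussianReal_of_var_ne_zero 0 one_ne_zero,
          setLIntegral_withDensity_eq_setLIntegral_mul_non_measurable _
            (measurable_gaussianPDF 0 1) _ measurableSet_Ioi
            (ae_of_all _ fun _ => gaussianPDF_lt_top)]
        rfl
    _ = ∫⁻ u in Set.Ioi 0, ∫⁻ v in Set.Ioi c, ENNReal.ofReal (2 * Real.pi)⁻¹ *
          ENNReal.ofReal (u * Real.exp (-((1 + v ^ 2) / 2) * u ^ 2)) := by
        refine setLIntegral_congr_fun measurableSet_Ioi fun u hu => ?_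
        simp only [← hpdf u _ hu]
        have hm := measurable_gaussianPDF 0 1
        rw [gaussianReal_apply _ one_ne_zero, lintegral_Ioi_mul_comp_mul hm c hu,
          ← lintegral_const_mul _ (by fun_prop)]
    _ = ∫⁻ v in Set.Ioi c, ∫⁻ u in Set.Ioi 0, ENNReal.ofReal (2 * Real.pi)⁻¹ *
          ENNReal.ofReal (u * Real.exp (-((1 + v ^ 2) / 2) * u ^ 2)) :=
        lintegral_lintegral_swap (by fun_prop)
    _ = ∫⁻ v in Set.Ioi c, ENNReal.ofReal (2 * Real.pi)⁻¹ * ENNReal.ofReal (1 + v ^ 2)⁻¹ := by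
        refine lintegral_congr fun v => ?_
        rw [lintegral_const_mul _ (by fun_prop), lintegral_Ioi_mul_exp_neg_mul_sq (by positivity),
          mul_div_cancel₀ _ two_ne_zero]
    _ = ENNReal.ofReal ((2 * Real.pi)⁻¹ * (Real.pi / 2 - Real.arctan c)) := by
        rw [lintegral_const_mul _ (by fun_prop), lintegral_Ioi_inv_one_add_sq,
          ← ENNReal.ofReal_mul (by positivity)]

/-- The correlation of the indicators of two events of probability `1 / 2`. -/
theorem correlation_ite_of_prob_half {Ω : Type*} [MeasurableSpace Ω] {μ : Measure Ω}
    [IsProbabilityMeasure μ] {p q : Ω → Prop} [DecidablePred p] [DecidablePred q]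
    (hp : MeasurableSet {ω | p ω}) (hq : MeasurableSet {ω | q ω})
    (hp_half : μ.real {ω | p ω} = 1 / 2) (hq_half : μ.real {ω | q ω} = 1 / 2) :
    correlation μ (fun ω => if p ω then (1 : ℝ) else 0) (fun ω => if q ω then (1 : ℝ) else 0) =
      4 * μ.real {ω | p ω ∧ q ω} - 1 := by
  have hint {r : Ω → Prop} [DecidablePred r] (hr : MeasurableSet {ω | r ω}) :
      ∫ ω, (if r ω then (1 : ℝ) else 0) ∂μ = μ.real {ω | r ω} := by
    rw [← integral_indicator_one hr]
    simp [Set.indicator]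
  have hvar {r : Ω → Prop} [DecidablePred r] (hr : MeasurableSet {ω | r ω})
      (hr_half : μ.real {ω | r ω} = 1 / 2) :
      variance (fun ω => if r ω then (1 : ℝ) else 0) μ = 1 / 4 := by
    have hm : Measurable (fun ω => if r ω then (1 : ℝ) else 0) :=
      Measurable.ite hr measurable_const measurable_const
    have hL : MemLp (fun ω => if r ω then (1 : ℝ) else 0) 2 μ :=
      MemLp.of_bound hm.aestronglyMeasurable 1 (ae_of_all _ fun ω => by split_ifs <;> simp)
    have hsq : (fun ω => if r ω then (1 : ℝ) else 0) ^ 2 =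
        fun ω => if r ω then (1 : ℝ) else 0 := by
      ext ω
      simp
    rw [variance_eq_sub hL, hsq, hint hr, hr_half]
    norm_num
  have hmul : ∫ ω, (if p ω then (1 : ℝ) else 0) * (if q ω then (1 : ℝ) else 0) ∂μ =
      μ.real {ω | p ω ∧ q ω} := by
    rw [← hint (r := fun ω => p ω ∧ q ω) (hp.inter hq)]
    refine integral_congr_ae (ae_of_all _ fun ω => ?_)
    by_cases h₁ : p ω <;> by_cases h₂ : q ω <;> simp [h₁, h₂]
  have hsqrt : √((1 / 4 : ℝ) * (1 / 4)) = 1 / 4 := Real.sqrt_mul_self (by norm_num)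
  rw [correlation, hmul, hint hp, hint hq, hvar hp hp_half, hvar hq hq_half, hp_half, hq_half,
    hsqrt]
  ring

/-- **Orthant probability for a bivariate Gaussian vector.**
Let `(X, Y)` be jointly Gaussian (i.e. every linear combination `aX + bY` is Gaussian
with mean `0` and variance `a² + 2abρ + b²`), with standard marginals and correlation
`ρ ∈ (-1,1)`. Then `ℙ(X > 0, Y > 0) = 1/4 + (1/(2π)) arctan(ρ/√(1-ρ²))` and consequently
`corr(𝟙[X>0], 𝟙[Y>0]) = (2/π) arctan(ρ/√(1-ρ²))`. -/
theorem gaussian_orthant_probability_and_indicator_correlation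
    {Ω : Type*} [MeasureSpace Ω] [IsProbabilityMeasure (ℙ : Measure Ω)]
    (X Y : Ω → ℝ) (hX : Measurable X) (hY : Measurable Y)
    (ρ : ℝ) (hρ : ρ ∈ Set.Ioo (-1 : ℝ) 1)
    (hjoint : ∀ a b : ℝ, Measure.map (fun ω => a * X ω + b * Y ω) ℙ =
      gaussianReal 0 (a ^ 2 + 2 * a * b * ρ + b ^ 2).toNNReal) :
    ℙ {ω | 0 < X ω ∧ 0 < Y ω} =
      ENNReal.ofReal (1 / 4 + (1 / (2 * Real.pi)) *
        Real.arctan (ρ / Real.sqrt (1 - ρ ^ 2))) ∧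
    correlation ℙ (fun ω => if 0 < X ω then (1 : ℝ) else 0)
        (fun ω => if 0 < Y ω then (1 : ℝ) else 0) =
      (2 / Real.pi) * Real.arctan (ρ / Real.sqrt (1 - ρ ^ 2)) := by
  obtain ⟨hρ₁, hρ₂⟩ := hρ
  have hpos : 0 < 1 - ρ ^ 2 := by nlinarith
  set s := √(1 - ρ ^ 2)
  have hs : 0 < s := Real.sqrt_pos.2 hpos
  have hs_sq : s ^ 2 = 1 - ρ ^ 2 := Real.sq_sqrt hpos.le
  set t := ρ / s with ht
  have harctan := Real.neg_pi_div_two_lt_arctan t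
  have hW : Measurable fun ω => (Y ω - ρ * X ω) / s := by fun_prop
  have hlaw : Measure.map (fun ω => (X ω, (Y ω - ρ * X ω) / s)) ℙ =
      (gaussianReal 0 1).prod (gaussianReal 0 1) := by
    refine map_prodMk_eq_gaussianReal_prod hX hW fun a b => ?_
    convert hjoint (a - b * ρ / s) (b / s) using 2
    · ext ω
      ring
    · congr 1
      field_simp
      linear_combination b ^ 2 * hs_sq
  have horthant : ℙ {ω | 0 < X ω ∧ 0 < Y ω} =
      ENNReal.ofReal (1 / 4 + (1 / (2 * Real.pi)) * Real.arctan t) := by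
    have hset : {ω | 0 < X ω ∧ 0 < Y ω} = (fun ω => (X ω, (Y ω - ρ * X ω) / s)) ⁻¹'
        {p : ℝ × ℝ | 0 < p.1 ∧ p.1 * (-t) < p.2} := by
      ext ω
      refine and_congr_right fun _ => ?_
      have : (Y ω - ρ * X ω) / s - X ω * (-t) = Y ω / s := by
        rw [ht]
        ring
      rw [← sub_pos (a := (Y ω - ρ * X ω) / s), this, div_pos_iff_of_pos_right hs]
    have hmeas : MeasurableSet {p : ℝ × ℝ | 0 < p.1 ∧ p.1 * (-t) < p.2} :=
      (measurableSet_lt measurable_const measurable_fst).inter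
        (measurableSet_lt (measurable_fst.mul_const _) measurable_snd)
    rw [hset, ← Measure.map_apply (hX.prodMk hW) hmeas, hlaw, gaussianReal_prod_sector,
      Real.arctan_neg]
    congr 1
    have := Real.pi_pos
    field_simp
    ring
  have hhalf {Z : Ω → ℝ} (hZ : Measurable Z) (hlawZ : Measure.map Z ℙ = gaussianReal 0 1) :
      (ℙ : Measure Ω).real {ω | 0 < Z ω} = 1 / 2 := by
    have : ℙ {ω | 0 < Z ω} = 2⁻¹ := by
      rw [← gaussianReal_zero_one_Ioi_zero, ← hlawZ, Measure.map_apply hZ measurableSet_Ioi]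
      rfl
    simp [measureReal_def, this]
  refine ⟨horthant, ?_⟩
  rw [correlation_ite_of_prob_half (measurableSet_lt measurable_const hX)
    (measurableSet_lt measurable_const hY) (hhalf hX (by simpa using hjoint 1 0))
    (hhalf hY (by simpa using hjoint 0 1)), measureReal_def, horthant, ENNReal.toReal_ofReal]
  · have := Real.pi_pos
    field_simp
    ring
  · have := Real.pi_pos
    have h : 1 / 4 + 1 / (2 * Real.pi) * Real.arctan t =
        (1 / (2 * Real.pi)) * (Real.pi / 2 + Real.arctan t) := by
      field_simp
      ring
    rw [h]
    exact mul_nonneg (by positivity) (by linarith)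
end

section
/- Let 𝒫 = {p₁ < p₂ < ...} be an increasing set of positive real numbers with p₁ ≥ 1 and pₙ → ∞ whose counting function satisfies π(x) = (1 + o(1))·x·(log x)^α as x → ∞, for a fixed real α. Then for each fixed β ∈ {0, 1, 2}, as σ → 1/2⁺, Σ_{p∈𝒫} (log p)^β p^{−2σ} = (1 + o(1)) · ∫_2^∞ (log x)^{α+β} x^{−2σ} dx + O(1). -/
open MeasureTheory Filter
open scoped Topology

theorem lintegral_antitone_le_of_measure_Iic_le {μ ν : Measure ℝ} {K C : ENNReal}
    (h : ∀ t, μ (Set.Iic t) ≤ K * ν (Set.Iic t) + C) {f : ℝ → ℝ} {M : ℝ}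
    (hanti : Antitone f) (hcont : Continuous f) (hnonneg : ∀ x, 0 ≤ f x) (hle : ∀ x, f x ≤ M)
    (hlim : Tendsto f atTop (𝓝 0)) :
    ∫⁻ x, ENNReal.ofReal (f x) ∂μ ≤
      K * ∫⁻ x, ENNReal.ofReal (f x) ∂ν + C * ENNReal.ofReal M := by
  have hlevel : ∀ u ∈ Set.Ioi (0 : ℝ), μ {x | u ≤ f x} ≤
      K * ν {x | u ≤ f x} + (Set.Iic M).indicator (fun _ => C) u := by
    intro u hu
    rcases Set.eq_empty_or_nonempty {x | u ≤ f x} with hempty | hne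
    · simp [hempty]
    · have hbdd : BddAbove {x | u ≤ f x} := by
        obtain ⟨T, hT⟩ := (hlim.eventually_lt_const (Set.mem_Ioi.1 hu)).exists
        exact ⟨T, fun x hx => le_of_not_gt fun hlt =>
          (hT.trans_le hx).not_ge (hanti hlt.le)⟩
      have hmem := (isClosed_le continuous_const hcont).csSup_mem hne hbdd
      have hIic : {x | u ≤ f x} = Set.Iic (sSup {x | u ≤ f x}) := by
        ext x
        exact ⟨fun hx => le_csSup hbdd hx, fun hx => le_trans hmem (hanti hx)⟩
      have huM : u ∈ Set.Iic M := hne.elim fun x hx => le_trans hx (hle x)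
      rw [Set.indicator_of_mem huM, hIic]
      exact h _
  have hlayer : ∀ m : Measure ℝ, ∫⁻ x, ENNReal.ofReal (f x) ∂m =
      ∫⁻ u in Set.Ioi 0, m {x | u ≤ f x} := fun m =>
    lintegral_eq_lintegral_meas_le m (ae_of_all _ hnonneg) hcont.aemeasurable
  have hmeas : Measurable fun u : ℝ => ν {x | u ≤ f x} :=
    Antitone.measurable fun u v huv => measure_mono fun x hx => le_trans huv hx
  rw [hlayer μ, hlayer ν]
  calc ∫⁻ u in Set.Ioi 0, μ {x | u ≤ f x}
      ≤ ∫⁻ u in Set.Ioi 0, (K * ν {x | u ≤ f x} + (Set.Iic M).indicator (fun _ => C) u) :=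
        setLIntegral_mono' measurableSet_Ioi hlevel
    _ = K * (∫⁻ u in Set.Ioi 0, ν {x | u ≤ f x}) + C * ENNReal.ofReal M := by
        rw [lintegral_add_left (hmeas.const_mul K), lintegral_const_mul K hmeas,
          lintegral_indicator measurableSet_Iic, setLIntegral_const,
          Measure.restrict_apply measurableSet_Iic, Set.inter_comm, Set.Ioi_inter_Iic,
          Real.volume_Ioc, sub_zero]

theorem antitoneOn_log_pow_div_rpow (β : ℕ) {s : ℝ} (hs : 1 ≤ s) :
    AntitoneOn (fun x : ℝ => Real.log x ^ β / x ^ s) (Set.Ici (Real.exp β)) := by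
  have hs0 : 0 < s := by linarith
  rcases Nat.eq_zero_or_pos β with rfl | hβ
  · intro x hx y hy hxy
    have hx0 : 0 < x := (Real.exp_pos _).trans_le hx
    simp only [pow_zero]
    gcongr
  · have hβ' : (0 : ℝ) < β := by exact_mod_cast hβ
    intro x hx y hy hxy
    have hsub : Set.Ici (Real.exp β) ⊆ Set.Ici (Real.exp (s / β)⁻¹) := by
      refine Set.Ici_subset_Ici.2 (Real.exp_le_exp.2 ?_)
      rw [inv_div]
      exact div_le_self hβ'.le hs
    have hroot : ∀ z ∈ Set.Ici (Real.exp (β : ℝ)),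
        Real.log z ^ β / z ^ s = (Real.log z / z ^ (s / β)) ^ β := by
      intro z hz
      have hz0 : 0 < z := (Real.exp_pos _).trans_le hz
      rw [div_pow, ← Real.rpow_natCast (z ^ (s / β)), ← Real.rpow_mul hz0.le,
        div_mul_cancel₀ _ hβ'.ne']
    have hy1 : 1 ≤ y := (Real.one_le_exp hβ'.le).trans hy
    change Real.log y ^ β / y ^ s ≤ Real.log x ^ β / x ^ s
    rw [hroot x hx, hroot y hy]
    refine pow_le_pow_left₀ (div_nonneg (Real.log_nonneg hy1) (by positivity)) ?_ β
    exact Real.log_div_self_rpow_antitoneOn (div_pos hs0 hβ') (hsub hx) (hsub hy) hxy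

theorem tendsto_log_pow_div_rpow_atTop (β : ℕ) {s : ℝ} (hs : 0 < s) :
    Tendsto (fun x : ℝ => Real.log x ^ β / x ^ s) atTop (𝓝 0) := by
  simpa using (isLittleO_log_rpow_rpow_atTop (β : ℝ) hs).tendsto_div_nhds_zero

theorem lintegral_log_pow_div_rpow_le {μ ν : Measure ℝ} {K C : ENNReal} (β : ℕ)
    (hμ : μ (Set.Iio 1) = 0) (hν : ν (Set.Iio 1) = 0)
    (h : ∀ t, μ (Set.Iic t) ≤ K * ν (Set.Iic t) + C) {s : ℝ} (hs : 1 ≤ s) :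
    ∫⁻ x, ENNReal.ofReal (Real.log x ^ β / x ^ s) ∂μ ≤
      K * ∫⁻ x, ENNReal.ofReal (Real.log x ^ β / x ^ s) ∂ν +
        ENNReal.ofReal ((β : ℝ) ^ β) *
          (K * ν (Set.Iic (Real.exp β)) + C + μ (Set.Iic (Real.exp β))) := by
  set X := Real.exp β with hX
  set M : ℝ := (β : ℝ) ^ β with hM
  set f : ℝ → ℝ := fun x => Real.log x ^ β / x ^ s with hf
  have hX1 : 1 ≤ X := Real.one_le_exp (Nat.cast_nonneg β)
  have hanti := antitoneOn_log_pow_div_rpow β hs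
  have hgX : ∀ x, max x X ∈ Set.Ici X := fun x => le_max_right x X
  have hfle : ∀ x, 1 ≤ x → f x ≤ Real.log x ^ β := fun x hx =>
    div_le_self (pow_nonneg (Real.log_nonneg hx) β) (Real.one_le_rpow hx (by linarith))
  have hfX : f X ≤ M := by simpa [hX, hM] using hfle X hX1
  have hgle : ∀ x, f (max x X) ≤ M := fun x =>
    (hanti (Set.self_mem_Ici) (hgX x) (hgX x)).trans hfX
  have hganti : Antitone fun x => f (max x X) := fun x y hxy =>
    hanti (hgX x) (hgX y) (max_le_max_right X hxy)
  have hgnonneg : ∀ x, 0 ≤ f (max x X) := fun x => by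
    have := hX1.trans (hgX x)
    exact div_nonneg (pow_nonneg (Real.log_nonneg this) β) (by positivity)
  have hglim : Tendsto (fun x => f (max x X)) atTop (𝓝 0) :=
    (tendsto_log_pow_div_rpow_atTop β (by linarith)).comp
      (tendsto_atTop_mono (fun x => le_max_left x X) tendsto_id)
  have hgcont : Continuous fun x => f (max x X) := by
    have hpos : ∀ x, max x X ≠ 0 := fun x => by
      have := hX1.trans (hgX x)
      positivity
    have hmax : Continuous fun x : ℝ => max x X := by fun_prop
    refine ((hmax.log hpos).pow β).div (hmax.rpow_const fun x => Or.inl (hpos x)) fun x => ?_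
    have := hX1.trans (hgX x)
    positivity
  have hsum : ∀ (m : Measure ℝ) (g₁ g₂ : ℝ → ℝ), m (Set.Iio 1) = 0 →
      (∀ x, 1 ≤ x → x ≤ X → g₁ x ≤ M) → (∀ x, X < x → g₁ x ≤ g₂ x) →
      ∫⁻ x, ENNReal.ofReal (g₁ x) ∂m ≤
        ∫⁻ x, ENNReal.ofReal (g₂ x) ∂m + ENNReal.ofReal M * m (Set.Iic X) := by
    intro m g₁ g₂ hm hsmall hlarge
    have hae : ∀ᵐ x ∂m, 1 ≤ x := by
      rw [ae_iff]
      simpa [Set.Iio] using hm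
    calc ∫⁻ x, ENNReal.ofReal (g₁ x) ∂m
        ≤ ∫⁻ x, (ENNReal.ofReal (g₂ x) +
            (Set.Iic X).indicator (fun _ => ENNReal.ofReal M) x) ∂m := by
          refine lintegral_mono_ae (hae.mono fun x hx => ?_)
          rcases le_or_gt x X with hxX | hxX
          · rw [Set.indicator_of_mem (Set.mem_Iic.2 hxX)]
            exact (ENNReal.ofReal_le_ofReal (hsmall x hx hxX)).trans le_add_self
          · exact (ENNReal.ofReal_le_ofReal (hlarge x hxX)).trans le_self_add
      _ = _ := by
          rw [lintegral_add_right _ (measurable_const.indicator measurableSet_Iic),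
            lintegral_indicator measurableSet_Iic, setLIntegral_const]
  have hμle := hsum μ f (fun x => f (max x X)) hμ
    (fun x hx hxX => (hfle x hx).trans (pow_le_pow_left₀ (Real.log_nonneg hx)
      ((Real.log_le_log (by linarith) hxX).trans_eq (Real.log_exp _)) β))
    (fun x hx => by rw [max_eq_left hx.le])
  have hνle := hsum ν (fun x => f (max x X)) f hν (fun x _ _ => hgle x)
    (fun x hx => by rw [max_eq_left hx.le])
  have hmid := lintegral_antitone_le_of_measure_Iic_le h hganti hgcont hgnonneg hgle hglim
  calc ∫⁻ x, ENNReal.ofReal (f x) ∂μ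
      ≤ (K * (∫⁻ x, ENNReal.ofReal (f x) ∂ν + ENNReal.ofReal M * ν (Set.Iic X)) +
          C * ENNReal.ofReal M) + ENNReal.ofReal M * μ (Set.Iic X) := by
        refine hμle.trans ?_
        gcongr
        refine hmid.trans ?_
        gcongr
    _ = _ := by ring

theorem continuousOn_log_rpow (γ : ℝ) : ContinuousOn (fun x : ℝ => Real.log x ^ γ) (Set.Ioi 1) :=
  fun x hx => ((Real.continuousAt_log (by linarith [Set.mem_Ioi.1 hx])).rpow_const
    (Or.inl (Real.log_pos hx).ne')).continuousWithinAt

theorem intervalIntegrable_log_rpow (γ : ℝ) {t : ℝ} (ht : 2 ≤ t) :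
    IntervalIntegrable (fun x : ℝ => Real.log x ^ γ) volume 2 t :=
  ((continuousOn_log_rpow γ).mono fun x hx => by
    rw [Set.uIcc_of_le ht] at hx
    exact lt_of_lt_of_le one_lt_two hx.1).intervalIntegrable

theorem hasDerivAt_integral_log_rpow (α : ℝ) {t : ℝ} (ht : 2 ≤ t) :
    HasDerivAt (fun u => ∫ x in (2 : ℝ)..u, Real.log x ^ α) (Real.log t ^ α) t := by
  have hnhds : Set.Ioi (1 : ℝ) ∈ 𝓝 t := Ioi_mem_nhds (by linarith)
  exact intervalIntegral.integral_hasDerivAt_right (intervalIntegrable_log_rpow α ht)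
    ⟨_, hnhds, (continuousOn_log_rpow α).aestronglyMeasurable measurableSet_Ioi⟩
    ((continuousOn_log_rpow α).continuousAt hnhds)

theorem hasDerivAt_mul_log_rpow (α : ℝ) {t : ℝ} (ht : 1 < t) :
    HasDerivAt (fun u : ℝ => u * Real.log u ^ α)
      (Real.log t ^ α * (1 + α / Real.log t)) t := by
  have hlog := Real.log_pos ht
  have ht0 : t ≠ 0 := by linarith
  refine ((hasDerivAt_id' t).mul
    ((Real.hasDerivAt_log ht0).rpow_const (p := α) (Or.inl hlog.ne'))).congr_deriv ?_
  rw [Real.rpow_sub_one hlog.ne']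
  field_simp

theorem exists_forall_ge_le_add_of_deriv_le {f g f' g' : ℝ → ℝ} {T : ℝ}
    (hf : ∀ t ≥ T, HasDerivAt f (f' t) t) (hg : ∀ t ≥ T, HasDerivAt g (g' t) t)
    (hle : ∀ t ≥ T, f' t ≤ g' t) : ∃ C, ∀ t ≥ T, f t ≤ g t + C := by
  have hderiv : ∀ t ≥ T, HasDerivAt (fun u => g u - f u) (g' t - f' t) t := fun t ht =>
    (hg t ht).sub (hf t ht)
  have hmono : MonotoneOn (fun u => g u - f u) (Set.Ici T) := by
    refine monotoneOn_of_deriv_nonneg (convex_Ici T)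
      (fun t ht => (hderiv t ht).continuousAt.continuousWithinAt)
      (fun t ht => (hderiv t (interior_subset ht)).differentiableAt.differentiableWithinAt)
      fun t ht => ?_
    rw [(hderiv t (interior_subset ht)).deriv]
    exact sub_nonneg.2 (hle t (interior_subset ht))
  refine ⟨f T - g T, fun t ht => ?_⟩
  have := hmono Set.self_mem_Ici ht ht
  simp only at this
  linarith

theorem exists_eventually_integral_log_rpow_comparison (α : ℝ) {k : ℝ} (hk : 1 < k) :
    ∃ C : ℝ, ∀ᶠ t : ℝ in atTop,
      (∫ x in (2 : ℝ)..t, Real.log x ^ α) ≤ k * (t * Real.log t ^ α) + C ∧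
      t * Real.log t ^ α ≤ k * (∫ x in (2 : ℝ)..t, Real.log x ^ α) + C := by
  have hlim : Tendsto (fun t : ℝ => 1 + α / Real.log t) atTop (𝓝 1) := by
    simpa using (Real.tendsto_log_atTop.const_div_atTop α).const_add 1
  have hlow : k⁻¹ < 1 := inv_lt_one_of_one_lt₀ hk
  obtain ⟨T, hT⟩ := eventually_atTop.1 ((hlim.eventually_lt_const hk).and
    ((hlim.eventually_const_lt hlow).and (eventually_ge_atTop 2)))
  have hV : ∀ t ≥ T, HasDerivAt (fun u => ∫ x in (2 : ℝ)..u, Real.log x ^ α)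
      (Real.log t ^ α) t := fun t ht => hasDerivAt_integral_log_rpow α (hT t ht).2.2
  have hL : ∀ t ≥ T, HasDerivAt (fun u : ℝ => u * Real.log u ^ α)
      (Real.log t ^ α * (1 + α / Real.log t)) t := fun t ht =>
    hasDerivAt_mul_log_rpow α (one_lt_two.trans_le (hT t ht).2.2)
  have hpow : ∀ t ≥ T, 0 ≤ Real.log t ^ α := fun t ht =>
    Real.rpow_nonneg (Real.log_nonneg (by linarith [(hT t ht).2.2])) α
  obtain ⟨C₁, hVL⟩ := exists_forall_ge_le_add_of_deriv_le hV (fun t ht => (hL t ht).const_mul k)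
    fun t ht => by
      have h1 : 1 ≤ k * (1 + α / Real.log t) :=
        (inv_le_iff_one_le_mul₀' (by linarith)).1 (hT t ht).2.1.le
      nlinarith [mul_le_mul_of_nonneg_left h1 (hpow t ht)]
  obtain ⟨C₂, hLV⟩ := exists_forall_ge_le_add_of_deriv_le hL (fun t ht => (hV t ht).const_mul k)
    fun t ht => by
      nlinarith [mul_le_mul_of_nonneg_left (hT t ht).1.le (hpow t ht)]
  exact ⟨max C₁ C₂, eventually_atTop.2 ⟨T, fun t ht =>
    ⟨(hVL t ht).trans (by gcongr; exact le_max_left _ _),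
      (hLV t ht).trans (by gcongr; exact le_max_right _ _)⟩⟩⟩

theorem exists_measure_Iic_le_of_eventually {μ ν : Measure ℝ} {K C : ENNReal} (hC : C ≠ ⊤)
    (hμ : ∀ t, μ (Set.Iic t) ≠ ⊤)
    (h : ∀ᶠ t in atTop, μ (Set.Iic t) ≤ K * ν (Set.Iic t) + C) :
    ∃ D : ENNReal, D ≠ ⊤ ∧ ∀ t, μ (Set.Iic t) ≤ K * ν (Set.Iic t) + D := by
  obtain ⟨T, hT⟩ := eventually_atTop.1 h
  refine ⟨C + μ (Set.Iic T), ENNReal.add_ne_top.2 ⟨hC, hμ T⟩, fun t => ?_⟩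
  rcases le_total T t with ht | ht
  · exact (hT t ht).trans (by gcongr; exact le_self_add)
  · exact (measure_mono (Set.Iic_subset_Iic.2 ht)).trans (le_add_self.trans le_add_self)

theorem exists_lintegral_log_pow_div_rpow_le {μ ν : Measure ℝ} {K C : ENNReal} (β : ℕ)
    (hK : K ≠ ⊤) (hC : C ≠ ⊤) (hμ : μ (Set.Iio 1) = 0) (hν : ν (Set.Iio 1) = 0)
    (hμ_fin : ∀ t, μ (Set.Iic t) ≠ ⊤) (hν_fin : ∀ t, ν (Set.Iic t) ≠ ⊤)
    (h : ∀ᶠ t in atTop, μ (Set.Iic t) ≤ K * ν (Set.Iic t) + C) :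
    ∃ D : ENNReal, D ≠ ⊤ ∧ ∀ s : ℝ, 1 ≤ s →
      ∫⁻ x, ENNReal.ofReal (Real.log x ^ β / x ^ s) ∂μ ≤
        K * ∫⁻ x, ENNReal.ofReal (Real.log x ^ β / x ^ s) ∂ν + D := by
  obtain ⟨D, hD, hμν⟩ := exists_measure_Iic_le_of_eventually hC hμ_fin h
  exact ⟨_, ENNReal.mul_ne_top ENNReal.ofReal_ne_top (ENNReal.add_ne_top.2
    ⟨ENNReal.add_ne_top.2 ⟨ENNReal.mul_ne_top hK (hν_fin _), hD⟩, hμ_fin _⟩),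
    fun s hs => lintegral_log_pow_div_rpow_le β hμ hν hμν hs⟩

theorem integrableOn_log_rpow_div_rpow (γ : ℝ) {s : ℝ} (hs : 1 < s) :
    IntegrableOn (fun x : ℝ => Real.log x ^ γ / x ^ s) (Set.Ioi 2) := by
  have hcont : ContinuousOn (fun x : ℝ => Real.log x ^ γ / x ^ s) (Set.Ici 2) := by
    refine ((continuousOn_log_rpow γ).mono (Set.Ici_subset_Ioi.2 one_lt_two)).div
      (fun x hx => ?_) fun x hx => ?_
    all_goals have hx0 : 0 < x := zero_lt_two.trans_le hx
    · exact (Real.continuousAt_rpow_const _ _ (Or.inl hx0.ne')).continuousWithinAt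
    · exact (Real.rpow_pos_of_pos hx0 s).ne'
  have hO : (fun x : ℝ => Real.log x ^ γ / x ^ s) =O[atTop] fun x => x ^ (-(1 + s) / 2) := by
    refine ((isLittleO_log_rpow_rpow_atTop γ (show 0 < (s - 1) / 2 by linarith)).isBigO.mul
      (Asymptotics.isBigO_refl (fun x : ℝ => (x ^ s)⁻¹) atTop)).congr' ?_ ?_
    · exact Eventually.of_forall fun x => (div_eq_mul_inv _ _).symm
    · filter_upwards [eventually_gt_atTop 0] with x hx
      rw [← Real.rpow_neg hx.le, ← Real.rpow_add hx]
      congr 1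
      ring
  exact ((hcont.locallyIntegrableOn measurableSet_Ici).integrableOn_of_isBigO_atTop hO
    ⟨Set.Ioi 1, Ioi_mem_atTop 1, integrableOn_Ioi_rpow_of_lt (by linarith) one_pos⟩).mono_set
      Set.Ioi_subset_Ici_self

theorem exists_eq_one_add_mul_add_of_comparison {S I : ℝ → ℝ} {a : ℝ}
    (hI : ∀ s > a, 0 ≤ I s) (hanti : AntitoneOn I (Set.Ioi a))
    (hcomp : ∀ k > (1 : ℝ), ∃ D : ℝ, ∀ s > a, S s ≤ k * I s + D ∧ I s ≤ k * S s + D) :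
    ∃ e B : ℝ → ℝ, Tendsto e (𝓝[>] a) (𝓝 0) ∧
      (∃ C : ℝ, ∀ᶠ s in 𝓝[>] a, |B s| ≤ C) ∧
      ∀ᶠ s in 𝓝[>] a, S s = (1 + e s) * I s + B s := by
  have hdiff : ∀ ε > (0 : ℝ), ∃ D : ℝ, ∀ s > a, |S s - I s| ≤ ε * I s + D := by
    intro ε hε
    obtain ⟨D, hD⟩ := hcomp (1 + ε) (by linarith)
    refine ⟨|D|, fun s hs => ?_⟩
    obtain ⟨h1, h2⟩ := hD s hs
    have hIs := hI s hs
    have hDabs := le_abs_self D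
    refine abs_le.2 ⟨?_, by linarith⟩
    have h3 : I s - |D| ≤ (1 + ε) * S s := by linarith
    by_contra! hlt
    have h4 : (1 + ε) * (S s) < (1 + ε) * (I s - ε * I s - |D|) :=
      mul_lt_mul_of_pos_left (by linarith) (by linarith)
    nlinarith [mul_nonneg hε.le (abs_nonneg D), mul_nonneg (mul_nonneg hε.le hε.le) hIs]
  by_cases hbdd : ∃ C, ∀ s > a, I s ≤ C
  · obtain ⟨C, hC⟩ := hbdd
    obtain ⟨D, hD⟩ := hdiff 1 one_pos
    refine ⟨fun _ => 0, fun s => S s - I s, tendsto_const_nhds, ⟨C + D, ?_⟩,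
      Eventually.of_forall fun s => by ring⟩
    filter_upwards [self_mem_nhdsWithin] with s hs
    linarith [hD s hs, hC s hs]
  · push Not at hbdd
    have htop : Tendsto I (𝓝[>] a) atTop := by
      refine tendsto_atTop.2 fun C => ?_
      obtain ⟨s, hs, hCs⟩ := hbdd C
      filter_upwards [Ioc_mem_nhdsGT hs] with t ht
      exact hCs.le.trans (hanti ht.1 hs ht.2)
    refine ⟨fun s => (S s - I s) / I s, fun _ => 0, ?_, ⟨0, by simp⟩, ?_⟩
    · refine Metric.tendsto_nhds.2 fun ε hε => ?_
      obtain ⟨D, hD⟩ := hdiff (ε / 2) (by linarith)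
      filter_upwards [self_mem_nhdsWithin, htop.eventually_gt_atTop 0,
        htop.eventually_gt_atTop (D / (ε / 2))] with s hs hpos hlarge
      rw [dist_zero_right, Real.norm_eq_abs, abs_div, abs_of_pos hpos, div_lt_iff₀ hpos]
      have := (div_lt_iff₀ (by linarith)).1 hlarge
      linarith [hD s hs]
    · filter_upwards [htop.eventually_gt_atTop 0] with s hpos
      field_simp
      ring

theorem count_map_Iic {p : ℕ → ℝ} (hptop : Tendsto p atTop atTop) (t : ℝ) :
    (Measure.count.map p) (Set.Iic t) = ENNReal.ofReal (Set.ncard {n : ℕ | p n ≤ t}) := by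
  have hfin : {n : ℕ | p n ≤ t}.Finite := by
    obtain ⟨N, hN⟩ := eventually_atTop.1 (hptop.eventually_gt_atTop t)
    exact (Set.finite_lt_nat N).subset fun n hn => lt_of_not_ge fun h => (hN n h).not_ge hn
  rw [Measure.map_apply measurable_from_nat measurableSet_Iic,
    Measure.count_apply (measurable_from_nat measurableSet_Iic)]
  change ((Set.encard {n : ℕ | p n ≤ t} : ℕ∞) : ENNReal) = _
  rw [← hfin.cast_ncard_eq, ENNReal.ofReal_natCast]
  simp

theorem withDensity_log_rpow_Iic (α : ℝ) {t : ℝ} (ht : 2 ≤ t) :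
    ((volume.restrict (Set.Ioi 2)).withDensity fun x => ENNReal.ofReal (Real.log x ^ α))
      (Set.Iic t) = ENNReal.ofReal (∫ x in (2 : ℝ)..t, Real.log x ^ α) := by
  rw [withDensity_apply _ measurableSet_Iic, Measure.restrict_restrict measurableSet_Iic,
    Set.inter_comm, Set.Ioi_inter_Iic, intervalIntegral.integral_of_le ht,
    ofReal_integral_eq_lintegral_ofReal (intervalIntegrable_log_rpow α ht).1]
  filter_upwards [ae_restrict_mem measurableSet_Ioc] with x hx
  exact Real.rpow_nonneg (Real.log_nonneg (by linarith [hx.1])) α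

theorem exists_eventually_counting_comparison {α : ℝ} {N : ℝ → ℝ}
    (hN : Tendsto (fun x : ℝ => N x / (x * Real.log x ^ α)) atTop (𝓝 1)) {k : ℝ} (hk : 1 < k) :
    ∃ C : ℝ, ∀ᶠ t : ℝ in atTop,
      N t ≤ k * (∫ x in (2 : ℝ)..t, Real.log x ^ α) + C ∧
      (∫ x in (2 : ℝ)..t, Real.log x ^ α) ≤ k * N t + C := by
  set r := √k with hr
  have hr1 : 1 < r := Real.lt_sqrt_of_sq_lt (by simpa using hk)
  have hrr : r * r = k := Real.mul_self_sqrt (by linarith)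
  obtain ⟨C, hC⟩ := exists_eventually_integral_log_rpow_comparison α hr1
  have hlow : r⁻¹ < 1 := inv_lt_one_of_one_lt₀ hr1
  refine ⟨r * |C|, ?_⟩
  filter_upwards [hC, hN.eventually_lt_const hr1, hN.eventually_const_lt hlow,
    eventually_gt_atTop 1] with t ⟨hVL, hLV⟩ hupper hlower ht
  have hL : 0 < t * Real.log t ^ α :=
    mul_pos (by linarith) (Real.rpow_pos_of_pos (Real.log_pos ht) α)
  have hNL : N t ≤ r * (t * Real.log t ^ α) := ((div_lt_iff₀ hL).1 hupper).le
  have hLN : t * Real.log t ^ α ≤ r * N t :=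
    (inv_mul_le_iff₀ (by linarith)).1 ((lt_div_iff₀ hL).1 hlower).le
  have hCabs : C ≤ |C| := le_abs_self C
  have hCr : |C| ≤ r * |C| := le_mul_of_one_le_left (abs_nonneg C) hr1.le
  constructor
  · calc N t ≤ r * (t * Real.log t ^ α) := hNL
      _ ≤ r * (r * (∫ x in (2 : ℝ)..t, Real.log x ^ α) + |C|) := by gcongr; linarith
      _ = _ := by rw [← hrr]; ring
  · calc (∫ x in (2 : ℝ)..t, Real.log x ^ α) ≤ r * (t * Real.log t ^ α) + C := hVL
      _ ≤ r * (r * N t) + r * |C| := by gcongr; linarith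
      _ = _ := by rw [← hrr]; ring

theorem lintegral_withDensity_log_rpow (α s : ℝ) (β : ℕ) :
    ∫⁻ x, ENNReal.ofReal (Real.log x ^ β / x ^ s)
      ∂((volume.restrict (Set.Ioi 2)).withDensity fun x => ENNReal.ofReal (Real.log x ^ α)) =
      ∫⁻ x in Set.Ioi 2, ENNReal.ofReal (Real.log x ^ (α + β) / x ^ s) := by
  rw [lintegral_withDensity_eq_lintegral_mul _ (by fun_prop) (by fun_prop)]
  refine setLIntegral_congr_fun measurableSet_Ioi fun x hx => ?_
  have hlog : 0 < Real.log x := Real.log_pos (one_lt_two.trans hx)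
  rw [Pi.mul_apply, ← ENNReal.ofReal_mul (Real.rpow_nonneg hlog.le α), Real.rpow_add hlog,
    Real.rpow_natCast, mul_div_assoc]

theorem toReal_le_mul_toReal_add {a b D : ENNReal} {k : ℝ} (hk : 0 ≤ k) (hb : b ≠ ⊤) (hD : D ≠ ⊤)
    (h : a ≤ ENNReal.ofReal k * b + D) : a.toReal ≤ k * b.toReal + D.toReal := by
  have hkb : ENNReal.ofReal k * b ≠ ⊤ := ENNReal.mul_ne_top ENNReal.ofReal_ne_top hb
  have := ENNReal.toReal_mono (ENNReal.add_ne_top.2 ⟨hkb, hD⟩) h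
  rwa [ENNReal.toReal_add hkb hD, ENNReal.toReal_mul, ENNReal.toReal_ofReal hk] at this

/-- **Comparison of `∑_{p ∈ 𝒫} (log p)^β p^{-2σ}` with an integral, for `β ∈ {0,1,2}`.**
Let `𝒫 = {p 0 < p 1 < ...}` be an increasing sequence of real numbers with `p 0 ≥ 1` and
`p n → ∞`, whose counting function satisfies `π(x) = (1+o(1)) x (log x)^α` as `x → ∞`.
Then for each `β ∈ {0,1,2}`, as `σ → 1/2⁺`,
`∑_{p ∈ 𝒫} (log p)^β p^{-2σ} = (1+o(1)) ∫_2^∞ (log x)^{α+β} x^{-2σ} dx + O(1)`. -/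
theorem dirichlet_sum_vs_integral_asymptotics
    (α : ℝ) (p : ℕ → ℝ) (hp1 : 1 ≤ p 0) (hpmono : StrictMono p)
    (hptop : Tendsto p atTop atTop)
    (hcount : Tendsto (fun x : ℝ => (Set.ncard {n : ℕ | p n ≤ x} : ℝ) /
      (x * Real.log x ^ α)) atTop (𝓝 1))
    (β : ℕ) (hβ : β ∈ ({0, 1, 2} : Set ℕ)) :
    ∃ e B : ℝ → ℝ,
      Tendsto e (𝓝[>] (1 / 2 : ℝ)) (𝓝 0) ∧
      (∃ C : ℝ, ∀ᶠ σ : ℝ in 𝓝[>] (1 / 2 : ℝ), |B σ| ≤ C) ∧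
      ∀ᶠ σ : ℝ in 𝓝[>] (1 / 2 : ℝ),
        ∑' n : ℕ, Real.log (p n) ^ β / p n ^ (2 * σ) =
          (1 + e σ) * (∫ x in Set.Ioi (2 : ℝ), Real.log x ^ (α + β) / x ^ (2 * σ)) +
            B σ := by
  set μ : Measure ℝ := Measure.count.map p with hμdef
  set ν : Measure ℝ :=
    (volume.restrict (Set.Ioi 2)).withDensity fun x => ENNReal.ofReal (Real.log x ^ α) with hνdef
  set N : ℝ → ℝ := fun x => (Set.ncard {n : ℕ | p n ≤ x} : ℝ)
  set V : ℝ → ℝ := fun t => ∫ x in (2 : ℝ)..t, Real.log x ^ α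
  set f : ℝ → ℝ → ℝ := fun s x => Real.log x ^ β / x ^ s
  have hμIic : ∀ t, μ (Set.Iic t) = ENNReal.ofReal (N t) := count_map_Iic hptop
  have hνIic : ∀ t, 2 ≤ t → ν (Set.Iic t) = ENNReal.ofReal (V t) := fun t ht =>
    withDensity_log_rpow_Iic α ht
  have hp : ∀ n, 1 ≤ p n := fun n => hp1.trans (hpmono.monotone (Nat.zero_le n))
  have hμ_one : μ (Set.Iio 1) = 0 := by
    rw [hμdef, Measure.map_apply measurable_from_nat measurableSet_Iio]
    have : p ⁻¹' Set.Iio 1 = ∅ := Set.eq_empty_of_forall_notMem fun n hn => (hp n).not_gt hn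
    rw [this, measure_empty]
  have hν_one : ν (Set.Iio 1) = 0 := by
    refine withDensity_absolutelyContinuous _ _ ?_
    rw [Measure.restrict_apply measurableSet_Iio]
    have : Set.Iio (1 : ℝ) ∩ Set.Ioi 2 = ∅ := by
      ext x
      simp only [Set.mem_inter_iff, Set.mem_Iio, Set.mem_Ioi, Set.mem_empty_iff_false, iff_false]
      rintro ⟨h1, h2⟩
      linarith
    rw [this, measure_empty]
  have hμ_fin : ∀ t, μ (Set.Iic t) ≠ ⊤ := fun t => hμIic t ▸ ENNReal.ofReal_ne_top
  have hν_fin : ∀ t, ν (Set.Iic t) ≠ ⊤ := fun t =>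
    ne_top_of_le_ne_top (hνIic (max t 2) (le_max_right t 2) ▸ ENNReal.ofReal_ne_top)
      (measure_mono (Set.Iic_subset_Iic.2 (le_max_left t 2)))
  have hμ_lint : ∀ s, ∫⁻ x, ENNReal.ofReal (f s x) ∂μ = ∑' n, ENNReal.ofReal (f s (p n)) :=
    fun s => by
      rw [hμdef, lintegral_map (by fun_prop) measurable_from_nat, lintegral_count]
  have hterm : ∀ s n, 0 ≤ f s (p n) := fun s n =>
    div_nonneg (pow_nonneg (Real.log_nonneg (hp n)) β)
      (Real.rpow_nonneg (zero_le_one.trans (hp n)) s)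
  set S : ℝ → ℝ := fun s => ∑' n, f s (p n)
  set I : ℝ → ℝ := fun s => ∫ x in Set.Ioi (2 : ℝ), Real.log x ^ (α + β) / x ^ s
  have hμS : ∀ s, (∫⁻ x, ENNReal.ofReal (f s x) ∂μ).toReal = S s := fun s => by
    rw [hμ_lint, ENNReal.tsum_toReal_eq fun n => ENNReal.ofReal_ne_top]
    exact tsum_congr fun n => ENNReal.toReal_ofReal (hterm s n)
  have hpos : ∀ s : ℝ, ∀ x ∈ Set.Ioi (2 : ℝ), 0 ≤ Real.log x ^ (α + β) / x ^ s := fun s x hx => by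
    have hx2 : 2 < x := hx
    exact div_nonneg (Real.rpow_nonneg (Real.log_nonneg (by linarith)) _)
      (Real.rpow_nonneg (by linarith) _)
  have hνI : ∀ s > 1, ∫⁻ x, ENNReal.ofReal (f s x) ∂ν = ENNReal.ofReal (I s) := fun s hs => by
    rw [hνdef, lintegral_withDensity_log_rpow,
      ofReal_integral_eq_lintegral_ofReal (integrableOn_log_rpow_div_rpow _ hs)
        ((ae_restrict_mem measurableSet_Ioi).mono (hpos s))]
  have hI_nonneg : ∀ s, 0 ≤ I s := fun s => setIntegral_nonneg measurableSet_Ioi (hpos s)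
  have hI_anti : AntitoneOn I (Set.Ioi 1) := fun s hs t ht hst =>
    setIntegral_mono_on (integrableOn_log_rpow_div_rpow _ ht)
      (integrableOn_log_rpow_div_rpow _ hs) measurableSet_Ioi fun x hx => by
        have hx2 : 2 < x := hx
        exact div_le_div_of_nonneg_left (Real.rpow_nonneg (Real.log_nonneg (by linarith)) _)
          (Real.rpow_pos_of_pos (by linarith) _)
          (Real.rpow_le_rpow_of_exponent_le (by linarith) hst)
  have hcomp : ∀ k > (1 : ℝ), ∃ D : ℝ, ∀ s > 1, S s ≤ k * I s + D ∧ I s ≤ k * S s + D := by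
    intro k hk
    have hk0 : 0 ≤ k := by linarith
    obtain ⟨C, hC⟩ := exists_eventually_counting_comparison hcount hk
    have hev : ∀ {a b : ℝ}, a ≤ k * b + C →
        ENNReal.ofReal a ≤ ENNReal.ofReal k * ENNReal.ofReal b + ENNReal.ofReal C := by
      intro a b hab
      rw [← ENNReal.ofReal_mul hk0]
      exact (ENNReal.ofReal_le_ofReal hab).trans ENNReal.ofReal_add_le
    obtain ⟨D₁, hD₁, hμν⟩ := exists_lintegral_log_pow_div_rpow_le (ν := ν) β
      (ENNReal.ofReal_ne_top (r := k)) (ENNReal.ofReal_ne_top (r := C)) hμ_one hν_one hμ_fin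
      hν_fin (by
        filter_upwards [hC, eventually_ge_atTop 2] with t ht ht2
        rw [hμIic, hνIic t ht2]
        exact hev ht.1)
    obtain ⟨D₂, hD₂, hνμ⟩ := exists_lintegral_log_pow_div_rpow_le (ν := μ) β
      (ENNReal.ofReal_ne_top (r := k)) (ENNReal.ofReal_ne_top (r := C)) hν_one hμ_one hν_fin
      hμ_fin (by
        filter_upwards [hC, eventually_ge_atTop 2] with t ht ht2
        rw [hμIic, hνIic t ht2]
        exact hev ht.2)
    refine ⟨max D₁.toReal D₂.toReal, fun s hs => ?_⟩
    have hνs : ∫⁻ x, ENNReal.ofReal (f s x) ∂ν ≠ ⊤ := hνI s hs ▸ ENNReal.ofReal_ne_top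
    have hμs : ∫⁻ x, ENNReal.ofReal (f s x) ∂μ ≠ ⊤ := ne_top_of_le_ne_top
      (ENNReal.add_ne_top.2 ⟨ENNReal.mul_ne_top ENNReal.ofReal_ne_top hνs, hD₁⟩) (hμν s hs.le)
    have hνI' : (∫⁻ x, ENNReal.ofReal (f s x) ∂ν).toReal = I s := by
      rw [hνI s hs, ENNReal.toReal_ofReal (hI_nonneg s)]
    have hreal₁ := toReal_le_mul_toReal_add hk0 hνs hD₁ (hμν s hs.le)
    have hreal₂ := toReal_le_mul_toReal_add hk0 hμs hD₂ (hνμ s hs.le)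
    rw [hνI', hμS] at hreal₁ hreal₂
    exact ⟨hreal₁.trans (by gcongr; exact le_max_left _ _),
      hreal₂.trans (by gcongr; exact le_max_right _ _)⟩
  obtain ⟨e, B, he, ⟨C, hC⟩, heq⟩ :=
    exists_eq_one_add_mul_add_of_comparison (fun s _ => hI_nonneg s) hI_anti hcomp
  have hdouble : Tendsto (fun σ : ℝ => 2 * σ) (𝓝[>] (1 / 2)) (𝓝[>] 1) := by
    refine tendsto_nhdsWithin_of_tendsto_nhds_of_eventually_within _ ?_ ?_
    · have : Tendsto (fun σ : ℝ => 2 * σ) (𝓝 (1 / 2)) (𝓝 (2 * (1 / 2))) :=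
        tendsto_id.const_mul 2
      norm_num at this
      simpa using this.mono_left nhdsWithin_le_nhds
    · filter_upwards [self_mem_nhdsWithin] with σ hσ
      have : 1 / 2 < σ := hσ
      exact Set.mem_Ioi.2 (by linarith)
  exact ⟨fun σ => e (2 * σ), fun σ => B (2 * σ), he.comp hdouble, ⟨C, hdouble.eventually hC⟩,
    hdouble.eventually heq⟩
end
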